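/- arXiv:1412.7843 — 3 statements merged into one kernel-verified Lean document; each statement's English description precedes it below -/
import Mathlib

section
/- (Theorem 1, Markov property of the radial part.) Let (Ω, ℱ, ℙ) be a probability space with a filtration (ℱ_t)_{t≥0}, let (x_t)_{t≥0} be an adapted X-valued process, and let (P_s)_{s≥0} be a family of K-invariant sub-probability kernels from X to X such that for all s, t ≥ 0 and every bounded measurable f : X → ℝ one has E[f(x_{t+s}) | ℱ_t] = ∫ f(z) P_s(x_t, dz) almost surely. Let J be an orbit projection for the action of K on X and set y_t = J(x_t). Then for all s, t ≥ 0 and every bounded measurable f : X → ℝ, E[f(y_{t+s}) | ℱ_t] = ∫ f(J(z)) P_s(y_t, dz) almost surely; that is, (y_t) is a Markov process whose transition kernels are Q_s(y, ·) = pushforward of P_s(y, ·) under J. -/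
open MeasureTheory ProbabilityTheory
open scoped NNReal

/-- Pushing a measure forward by `k` does not change integrals of functions invariant under `k`. -/
theorem integral_map_smul_of_invariant {X K : Type*} [MeasurableSpace X] [SMul K X] {k : K}
    (hk : Measurable fun z : X => k • z) (μ : Measure X) {g : X → ℝ} (hg : Measurable g)
    (hinv : ∀ z, g (k • z) = g z) :
    ∫ z, g z ∂(μ.map fun z => k • z) = ∫ z, g z ∂μ := by
  rw [integral_map hk.aemeasurable hg.aestronglyMeasurable]
  simp only [hinv]

/-- Theorem 1, Markov property of the radial part: if `x` is a Markov process
with `K`-invariant transition kernels `P s` and `J` is an orbit projection, then `y_t = J (x_t)`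
is a Markov process with transition kernels `Q_s (y, ·) = J_* (P s (y, ·))`. -/
theorem radial_part_is_markov
    {X : Type*} [MeasurableSpace X] {K : Type*} [Group K] [MulAction K X]
    (hKmeas : ∀ k : K, Measurable fun x : X => k • x)
    (J : X → X) (hJmeas : Measurable J)
    (hJinv : ∀ (k : K) (x : X), J (k • x) = J x)
    (hJorb : ∀ x : X, ∃ k : K, k • J x = x)
    {Ω : Type*} {m0 : MeasurableSpace Ω} (Pr : Measure Ω) [IsProbabilityMeasure Pr]
    (ℱ : Filtration ℝ≥0 m0)
    (x : ℝ≥0 → Ω → X)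
    (hadapt : ∀ t : ℝ≥0, Measurable[ℱ t] (x t))
    (P : ℝ≥0 → Kernel X X)
    (hPsub : ∀ (s : ℝ≥0) (x₀ : X), P s x₀ Set.univ ≤ 1)
    (hPinv : ∀ (s : ℝ≥0) (k : K) (x₀ : X), P s (k • x₀) = (P s x₀).map fun z => k • z)
    (hMarkov : ∀ (s t : ℝ≥0) (f : X → ℝ), Measurable f → (∃ C, ∀ z, |f z| ≤ C) →
      Pr[(fun ω => f (x (t + s) ω))|ℱ t] =ᵐ[Pr] fun ω => ∫ z, f z ∂(P s (x t ω)))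
    (s t : ℝ≥0) (f : X → ℝ) (hf : Measurable f) (hfb : ∃ C, ∀ z, |f z| ≤ C) :
    Pr[(fun ω => f (J (x (t + s) ω)))|ℱ t]
      =ᵐ[Pr] fun ω => ∫ z, f (J z) ∂(P s (J (x t ω))) := by
  have hfJ : Measurable fun z => f (J z) := hf.comp hJmeas
  obtain ⟨C, hC⟩ := hfb
  filter_upwards [hMarkov s t (fun z => f (J z)) hfJ ⟨C, fun z => hC (J z)⟩] with ω hω
  obtain ⟨k, hk⟩ := hJorb (x t ω)
  calc _ = ∫ z, f (J z) ∂(P s (x t ω)) := hω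
    _ = ∫ z, f (J z) ∂(P s (k • J (x t ω))) := by rw [hk]
    _ = ∫ z, f (J z) ∂(P s (J (x t ω))) := by
      rw [hPinv]
      exact integral_map_smul_of_invariant (hKmeas k) _ hfJ fun z => by rw [hJinv]
end

section
/- (Chapman–Kolmogorov equation for the radial semigroup.) Let (P_t)_{t≥0} be a family of K-invariant sub-probability kernels from X to X satisfying the semigroup property P_{t+s}(x, ·) = ∫ P_s(z, ·) P_t(x, dz) for all s, t ≥ 0 and x ∈ X, and let J be an orbit projection for the action of K on X. Define kernels Q_t by Q_t(x, ·) = pushforward of P_t(J(x), ·) under J. Then the family (Q_t) satisfies the semigroup property Q_{t+s}(x, ·) = ∫ Q_s(z, ·) Q_t(x, dz) for all s, t ≥ 0 and x ∈ X. -/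
open MeasureTheory ProbabilityTheory
open scoped NNReal

/-- For an invariant kernel `κ`, the law under `κ x` of an invariant measurable map `J` depends on `x`
only through its orbit. -/
theorem map_apply_smul_of_invariant {X Y : Type*} [MeasurableSpace X] [MeasurableSpace Y]
    {K : Type*} [SMul K X] {k : K} (hk : Measurable fun x : X => k • x)
    {J : X → Y} (hJ : Measurable J) (hJinv : ∀ x : X, J (k • x) = J x)
    {κ : Kernel X X} {x : X} (hκ : κ (k • x) = (κ x).map fun z => k • z) :
    (κ (k • x)).map J = (κ x).map J := by
  rw [hκ, Measure.map_map hJ hk]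
  exact congrArg (fun f => (κ x).map f) (funext hJinv)

/-- Chapman–Kolmogorov for the radial semigroup: if the `K`-invariant kernels
`P t` satisfy the semigroup property and `J` is an orbit projection, then the kernels
`Q t (x, ·) = J_* (P t (J x, ·))` also satisfy the semigroup property. -/
theorem radial_semigroup_chapman_kolmogorov
    {X : Type*} [MeasurableSpace X] {K : Type*} [Group K] [MulAction K X]
    (hKmeas : ∀ k : K, Measurable fun x : X => k • x)
    (J : X → X) (hJmeas : Measurable J)
    (hJinv : ∀ (k : K) (x : X), J (k • x) = J x)
    (hJorb : ∀ x : X, ∃ k : K, k • J x = x)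
    (P : ℝ≥0 → Kernel X X)
    (hPsub : ∀ (t : ℝ≥0) (x : X), P t x Set.univ ≤ 1)
    (hPinv : ∀ (t : ℝ≥0) (k : K) (x : X), P t (k • x) = (P t x).map fun z => k • z)
    (hsemi : ∀ (s t : ℝ≥0) (x : X), P (t + s) x = (P t x).bind fun z => P s z) :
    ∀ (s t : ℝ≥0) (x : X),
      (P (t + s) (J x)).map J
        = ((P t (J x)).map J).bind fun z => (P s (J z)).map J := by
  intro s t x
  have hmap (z : X) : (P s (J z)).map J = (P s z).map J := by
    obtain ⟨k, hk⟩ := hJorb z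
    have h := map_apply_smul_of_invariant (hKmeas k) hJmeas (hJinv k) (hPinv s k (J z))
    rw [hk] at h
    exact h.symm
  have hradial : Measurable fun z => (P s z).map J :=
    (Measure.measurable_map J hJmeas).comp (P s).measurable
  ext A hA
  have hmeas : Measurable fun z => (P s z).map J A :=
    (Measure.measurable_coe hA).comp hradial
  rw [Measure.map_apply hJmeas hA, hsemi,
    Measure.bind_apply (hJmeas hA) (P s).measurable.aemeasurable]
  simp_rw [hmap]
  rw [Measure.bind_apply hA hradial.aemeasurable,
    lintegral_map hmeas hJmeas]
  simp_rw [hmap, Measure.map_apply hJmeas hA]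
end

section
/- (Invariance of the disintegration kernel.) Let Y and Z be standard Borel spaces, M a group acting measurably on Z (for each m ∈ M the map z ↦ m•z is measurable), and ρ a finite measure on Y × Z such that for every m ∈ M the pushforward of ρ under (y, z) ↦ (y, m•z) equals ρ. Let ρ = ρ_Y ⊗ R be the disintegration of ρ, where ρ_Y is the first marginal of ρ and R is a conditional probability kernel from Y to Z (e.g., Mathlib's Measure.condKernel). Then for each fixed m ∈ M, for ρ_Y-almost every y ∈ Y, the pushforward of R(y, ·) under z ↦ m•z equals R(y, ·). -/
open MeasureTheory ProbabilityTheory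

/-- Invariance of the disintegration kernel: if a finite measure `ρ` on `Y × Z`
is invariant under `(y, z) ↦ (y, m • z)` for every `m` in a group `M` acting measurably on `Z`,
then for each fixed `m`, for `ρ.fst`-almost every `y` the conditional kernel `ρ.condKernel y`
is invariant under `z ↦ m • z`. -/
theorem condKernel_invariant_of_invariant_measure
    {Y Z : Type*} [MeasurableSpace Y] [StandardBorelSpace Y]
    [MeasurableSpace Z] [StandardBorelSpace Z] [Nonempty Z]
    {M : Type*} [Group M] [MulAction M Z]
    (hM : ∀ m : M, Measurable fun z : Z => m • z)
    (ρ : Measure (Y × Z)) [IsFiniteMeasure ρ]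
    (hρ : ∀ m : M, ρ.map (fun p : Y × Z => (p.1, m • p.2)) = ρ)
    (m : M) :
    ∀ᵐ y ∂ρ.fst, (ρ.condKernel y).map (fun z => m • z) = ρ.condKernel y := by
  have hκ : ρ = ρ.fst ⊗ₘ ρ.condKernel.map (fun z => m • z) := by
    rw [Measure.compProd_map (hM m), ρ.disintegrate ρ.condKernel]
    exact (hρ m).symm
  filter_upwards [eq_condKernel_of_measure_eq_compProd _ hκ] with y hy
  rw [← Kernel.map_apply _ (hM m), hy]
end
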